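/- arXiv:2503.10537 — 4 statements merged into one kernel-verified Lean document; each statement's English description precedes it below -/
import Mathlib

section
/- Let 𝒦 be a set of real d×d matrices closed under scalar multiplication, matrix addition, and matrix multiplication, with I_d ∈ 𝒦, and let 𝓗 = 𝒦 ∩ S₊^d. Then for every symmetric matrix A ∈ 𝒦, A is positive semidefinite if and only if ⟨H, A⟩ ≥ 0 for every H ∈ 𝓗. Consequently, for H₁, H₂ ∈ 𝓗, if ⟨H₁ − H₂, H⟩ ≥ 0 for every H ∈ 𝓗, then H₁ − H₂ is positive semidefinite. -/
open Matrix

/-- `⟨A,B⟩ := Tr(Aᵀ B)` for square real matrices. -/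
noncomputable def minner {n : Type*} [Fintype n] (A B : Matrix n n ℝ) : ℝ := (Aᵀ * B).trace

namespace Matrix

variable {n : Type*} [Fintype n]

open scoped MatrixOrder in
theorem PosSemidef.trace_mul_nonneg {A B : Matrix n n ℝ} (hA : A.PosSemidef)
    (hB : B.PosSemidef) : 0 ≤ (A * B).trace := by
  classical
  obtain ⟨C, rfl⟩ := CStarAlgebra.nonneg_iff_eq_star_mul_self.mp hA.nonneg
  rw [star_eq_conjTranspose, Matrix.mul_assoc, trace_mul_comm]
  exact (hB.mul_mul_conjTranspose_same C).trace_nonneg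

variable [DecidableEq n]

theorem IsSymm.aeval {A : Matrix n n ℝ} (hA : A.IsSymm) (p : Polynomial ℝ) :
    (Polynomial.aeval A p).IsSymm := by
  induction p using Polynomial.induction_on' with
  | add p q hp hq => simpa using hp.add hq
  | monomial k c =>
    simpa [Polynomial.aeval_monomial, Algebra.algebraMap_eq_smul_one] using (hA.pow k).smul c

/-- A spectral value of `A` has a nonzero polynomial in `A` as an eigenvector for left
multiplication by `A`. -/
theorem exists_aeval_ne_zero_mul_eq_smul {A : Matrix n n ℝ} {μ : ℝ} (hμ : μ ∈ spectrum ℝ A) :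
    ∃ p : Polynomial ℝ, Polynomial.aeval A p ≠ 0 ∧
      A * Polynomial.aeval A p = μ • Polynomial.aeval A p := by
  have : Nontrivial (Matrix n n ℝ) := by
    by_contra h
    rw [not_nontrivial_iff_subsingleton] at h
    simp [spectrum.of_subsingleton] at hμ
  have hroot : (minpoly ℝ A).IsRoot μ := by
    have h := spectrum.subset_polynomial_aeval A (minpoly ℝ A) (Set.mem_image_of_mem _ hμ)
    simpa using h
  obtain ⟨q, hq⟩ := Polynomial.dvd_iff_isRoot.mpr hroot
  have hne : minpoly ℝ A ≠ 0 := minpoly.ne_zero_of_finite ℝ A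
  have hq0 : q ≠ 0 := by
    rintro rfl
    exact hne (by simpa using hq)
  refine ⟨q, fun h => ?_, ?_⟩
  · have hdeg := minpoly.degree_le_of_ne_zero ℝ A hq0 h
    rw [hq, Polynomial.degree_mul, Polynomial.degree_X_sub_C,
      Polynomial.degree_eq_natDegree hq0] at hdeg
    norm_cast at hdeg
    omega
  · have h := minpoly.aeval ℝ A
    rw [hq] at h
    simpa [sub_mul, sub_eq_zero, Algebra.algebraMap_eq_smul_one] using h

/-- The positive semidefinite elements of a matrix algebra detect positive semidefiniteness of
its symmetric elements. -/
theorem posSemidef_of_forall_trace_mul_nonneg (S : Subalgebra ℝ (Matrix n n ℝ))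
    {A : Matrix n n ℝ} (hAS : A ∈ S) (hA : A.IsSymm)
    (h : ∀ H ∈ S, H.PosSemidef → 0 ≤ (H * A).trace) : A.PosSemidef := by
  refine posSemidef_iff_isHermitian_and_spectrum_nonneg.mpr
    ⟨by simpa [IsHermitian] using hA.eq, fun μ hμ => ?_⟩
  obtain ⟨p, hp0, hp⟩ := exists_aeval_ne_zero_mul_eq_smul hμ
  set P := Polynomial.aeval A p
  have hPsymm : Pᴴ = P := by simpa using (hA.aeval p).eq
  have hPS : P ∈ S :=
    Algebra.adjoin_le (by simpa using hAS) (Polynomial.aeval_mem_adjoin_singleton ℝ A)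
  have hPP : (P * P).PosSemidef := by
    simpa only [hPsymm] using posSemidef_conjTranspose_mul_self P
  have hpos : 0 < (P * P).trace := by
    refine lt_of_le_of_ne hPP.trace_nonneg fun h0 => hp0 ?_
    rw [eq_comm, hPP.trace_eq_zero_iff] at h0
    rwa [← conjTranspose_mul_self_eq_zero, hPsymm]
  have hnonneg := h (P * P) (S.mul_mem hPS hPS) hPP
  rw [trace_mul_comm, ← Matrix.mul_assoc, hp, smul_mul, trace_smul, smul_eq_mul] at hnonneg
  exact nonneg_of_mul_nonneg_left hnonneg hpos

end Matrix

theorem stmt_0 {d : ℕ} (K : Set (Matrix (Fin d) (Fin d) ℝ))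
    (hsmul : ∀ (c : ℝ), ∀ A ∈ K, c • A ∈ K)
    (hadd : ∀ A ∈ K, ∀ B ∈ K, A + B ∈ K)
    (hmul : ∀ A ∈ K, ∀ B ∈ K, A * B ∈ K)
    (hone : (1 : Matrix (Fin d) (Fin d) ℝ) ∈ K)
    (𝓗 : Set (Matrix (Fin d) (Fin d) ℝ))
    (h𝓗 : 𝓗 = K ∩ {M | M.PosSemidef}) :
    (∀ A ∈ K, A.IsSymm → (A.PosSemidef ↔ ∀ H ∈ 𝓗, 0 ≤ minner H A)) ∧
    (∀ H₁ ∈ 𝓗, ∀ H₂ ∈ 𝓗, (∀ H ∈ 𝓗, 0 ≤ minner (H₁ - H₂) H) → (H₁ - H₂).PosSemidef) := by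
  subst h𝓗
  let S : Subalgebra ℝ (Matrix (Fin d) (Fin d) ℝ) :=
    { carrier := K
      mul_mem' := fun ha hb => hmul _ ha _ hb
      add_mem' := fun ha hb => hadd _ ha _ hb
      algebraMap_mem' := fun c => by
        simpa [Algebra.algebraMap_eq_smul_one] using hsmul c 1 hone }
  have symm_of_posSemidef {H : Matrix (Fin d) (Fin d) ℝ} (hH : H.PosSemidef) : Hᵀ = H := by
    simpa using hH.isHermitian.eq
  refine ⟨fun A hAK hA => ⟨fun hpsd H hH => ?_, fun h => ?_⟩, fun H₁ hH₁ H₂ hH₂ h => ?_⟩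
  · rw [minner, symm_of_posSemidef hH.2]
    exact hH.2.trace_mul_nonneg hpsd
  · refine posSemidef_of_forall_trace_mul_nonneg S hAK hA fun H hHS hH => ?_
    simpa [minner, symm_of_posSemidef hH] using h H ⟨hHS, hH⟩
  · have hsymm : (H₁ - H₂).IsSymm := by
      rw [IsSymm, transpose_sub, symm_of_posSemidef hH₁.2, symm_of_posSemidef hH₂.2]
    refine posSemidef_of_forall_trace_mul_nonneg S (S.sub_mem hH₁.1 hH₂.1) hsymm
      fun H hHS hH => ?_
    rw [trace_mul_comm]
    simpa only [minner, hsymm.eq] using h H ⟨hHS, hH⟩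
end

section
/- Let 𝓗 be a well-structured preconditioner set in dimension d and let η > 0. For every symmetric positive definite d×d real matrix M there exists a unique positive definite matrix P ∈ 𝓗 such that ⟨M, P⁻¹⟩ + η²·Tr(P) ≤ ⟨M, H⁻¹⟩ + η²·Tr(H) for every positive definite H ∈ 𝓗, with equality only when H = P. -/
open Matrix

/-- A set of real `d × d` matrices closed under scalar multiplication, addition and
matrix multiplication, containing the identity. -/
def IsMatrixSubalgebra {d : ℕ} (K : Set (Matrix (Fin d) (Fin d) ℝ)) : Prop :=
  (∀ (c : ℝ), ∀ A ∈ K, c • A ∈ K) ∧ (∀ A ∈ K, ∀ B ∈ K, A + B ∈ K) ∧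
    (∀ A ∈ K, ∀ B ∈ K, A * B ∈ K) ∧ (1 : Matrix (Fin d) (Fin d) ℝ) ∈ K

/-- A well-structured preconditioner set: `𝓗 = 𝒦 ∩ S₊^d` for a matrix subalgebra `𝒦`. -/
def WellStructured {d : ℕ} (𝓗 : Set (Matrix (Fin d) (Fin d) ℝ)) : Prop :=
  ∃ K : Set (Matrix (Fin d) (Fin d) ℝ),
    IsMatrixSubalgebra K ∧ 𝓗 = K ∩ {M | M.PosSemidef}

open scoped MatrixOrder

namespace Matrix

theorem isCompact_setOf_abs_apply_le {n : Type*} (C : ℝ) :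
    IsCompact {A : Matrix n n ℝ | ∀ i j, |A i j| ≤ C} := by
  have h : IsCompact (Set.univ.pi fun _ : n => Set.univ.pi fun _ : n => Set.Icc (-C) C) :=
    isCompact_univ_pi fun _ => isCompact_univ_pi fun _ => isCompact_Icc
  refine h.of_isClosed_subset ?_ fun A hA i _ j _ => abs_le.1 (hA i j)
  simp only [Set.ofPred_forall]
  exact isClosed_iInter fun i => isClosed_iInter fun j =>
    isClosed_le (by fun_prop) continuous_const

variable {n : Type*} [Fintype n]

theorem PosSemidef.abs_apply_le_trace {A : Matrix n n ℝ} (hA : A.PosSemidef) (i j : n) :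
    |A i j| ≤ A.trace := by
  classical
  have hsymm : A j i = A i j := by simpa using hA.isHermitian.apply i j
  rcases eq_or_ne i j with rfl | hij
  · rw [abs_of_nonneg hA.diag_nonneg]
    exact Finset.single_le_sum (f := fun k => A k k) (fun k _ => hA.diag_nonneg)
      (Finset.mem_univ i)
  · have hdiag : A i i + A j j ≤ A.trace := by
      rw [← Finset.sum_pair (f := fun k => A k k) hij]
      exact Finset.sum_le_sum_of_subset_of_nonneg (Finset.subset_univ _)
        fun k _ _ => hA.diag_nonneg
    have hadd := hA.dotProduct_mulVec_nonneg (Pi.single i 1 + Pi.single j 1)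
    have hsub := hA.dotProduct_mulVec_nonneg (Pi.single i 1 - Pi.single j 1)
    simp [mulVec_add, mulVec_sub, hsymm] at hadd hsub
    have hi : 0 ≤ A i i := hA.diag_nonneg
    have hj : 0 ≤ A j j := hA.diag_nonneg
    rw [abs_le]
    constructor <;> linarith

theorem isClosed_setOf_posSemidef : IsClosed {A : Matrix n n ℝ | A.PosSemidef} := by
  simp only [posSemidef_iff_dotProduct_mulVec, Set.ofPred_and, Set.ofPred_forall]
  refine IsClosed.inter (isClosed_eq (by fun_prop) continuous_id) (isClosed_iInter fun x => ?_)
  exact isClosed_le continuous_const (by fun_prop)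

variable [DecidableEq n]

theorem PosDef.exists_isUnit_conjTranspose_mul_self {M : Matrix n n ℝ} (hM : M.PosDef) :
    ∃ B : Matrix n n ℝ, IsUnit B ∧ M = Bᴴ * B := by
  obtain ⟨B, hB⟩ := CStarAlgebra.nonneg_iff_eq_star_mul_self.mp hM.posSemidef.nonneg
  exact ⟨B, (isUnit_of_mul_isUnit_right (hB ▸ hM.isUnit)), hB⟩

theorem PosDef.trace_mul_nonneg {M X : Matrix n n ℝ} (hM : M.PosDef) (hX : X.PosSemidef) :
    0 ≤ (M * X).trace := by
  obtain ⟨B, -, rfl⟩ := hM.exists_isUnit_conjTranspose_mul_self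
  rw [mul_assoc, trace_mul_comm]
  exact (hX.mul_mul_conjTranspose_same B).trace_nonneg

theorem PosDef.trace_mul_eq_zero {M X : Matrix n n ℝ} (hM : M.PosDef) (hX : X.PosSemidef)
    (h : (M * X).trace = 0) : X = 0 := by
  obtain ⟨B, hB, rfl⟩ := hM.exists_isUnit_conjTranspose_mul_self
  rw [mul_assoc, trace_mul_comm, (hX.mul_mul_conjTranspose_same B).trace_eq_zero_iff] at h
  have hB' : IsUnit Bᴴ := hB.star
  exact (hB.mul_right_eq_zero).1 ((hB'.mul_left_eq_zero).1 h)

/-- A sublevel set of `X ↦ Tr (M X)` on the positive semidefinite cone is bounded. -/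
theorem PosDef.exists_isCompact_of_trace_mul_le {M : Matrix n n ℝ} (hM : M.PosDef) (C : ℝ) :
    ∃ S : Set (Matrix n n ℝ), IsCompact S ∧
      ∀ X : Matrix n n ℝ, X.PosSemidef → (M * X).trace ≤ C → X ∈ S := by
  obtain ⟨B, hB, rfl⟩ := hM.exists_isUnit_conjTranspose_mul_self
  refine ⟨(fun N => B⁻¹ * N * (Bᴴ)⁻¹) '' {N | ∀ i j, |N i j| ≤ C},
    (isCompact_setOf_abs_apply_le C).image (by fun_prop), fun X hX hC => ?_⟩
  have hdet : IsUnit B.det := (isUnit_iff_isUnit_det B).1 hB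
  have hdet' : IsUnit Bᴴ.det := (isUnit_iff_isUnit_det _).1 hB.star
  rw [mul_assoc, trace_mul_comm] at hC
  refine ⟨B * X * Bᴴ,
    fun i j => ((hX.mul_mul_conjTranspose_same B).abs_apply_le_trace i j).trans hC, ?_⟩
  simp only [mul_assoc]
  rw [mul_nonsing_inv _ hdet', nonsing_inv_mul_cancel_left _ _ hdet, mul_one]

/-- The matrix form of `1/h + 1/p - 4/(h+p) = (1/h - 1/p)² / (1/h + 1/p)`. -/
theorem PosDef.inv_add_inv_sub_inv_add {H P : Matrix n n ℝ} (hH : H.PosDef) (hP : P.PosDef) :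
    H⁻¹ + P⁻¹ - (4 : ℝ) • (H + P)⁻¹ =
      (H⁻¹ - P⁻¹) * (H⁻¹ + P⁻¹)⁻¹ * (H⁻¹ - P⁻¹) := by
  have hHd : IsUnit H.det := (isUnit_iff_isUnit_det _).1 hH.isUnit
  have hPd : IsUnit P.det := (isUnit_iff_isUnit_det _).1 hP.isUnit
  have hSd : IsUnit (H⁻¹ + P⁻¹).det := (isUnit_iff_isUnit_det _).1 (hH.inv.add hP.inv).isUnit
  have hHP : H * (H⁻¹ + P⁻¹) * P = H + P := by
    rw [mul_add, add_mul, mul_nonsing_inv _ hHd, one_mul, mul_assoc, nonsing_inv_mul _ hPd,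
      mul_one, add_comm]
  have hPH : P * (H⁻¹ + P⁻¹) * H = H + P := by
    rw [mul_add, add_mul, mul_nonsing_inv _ hPd, one_mul, mul_assoc, nonsing_inv_mul _ hHd,
      mul_one, add_comm]
  have h₁ : P⁻¹ * (H⁻¹ + P⁻¹)⁻¹ * H⁻¹ = (H + P)⁻¹ := by
    rw [← hHP, mul_inv_rev, mul_inv_rev, mul_assoc]
  have h₂ : H⁻¹ * (H⁻¹ + P⁻¹)⁻¹ * P⁻¹ = (H + P)⁻¹ := by
    rw [← hPH, mul_inv_rev, mul_inv_rev, mul_assoc]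
  have h₃ : (H⁻¹ + P⁻¹) * (H⁻¹ + P⁻¹)⁻¹ * (H⁻¹ + P⁻¹) = H⁻¹ + P⁻¹ := by
    rw [mul_nonsing_inv _ hSd, one_mul]
  generalize (H⁻¹ + P⁻¹)⁻¹ = Q at *
  have h₄ : (H⁻¹ - P⁻¹) * Q * (H⁻¹ - P⁻¹) = (H⁻¹ + P⁻¹) * Q * (H⁻¹ + P⁻¹)
      - (2 : ℝ) • (P⁻¹ * Q * H⁻¹) - (2 : ℝ) • (H⁻¹ * Q * P⁻¹) := by
    simp only [two_smul]
    noncomm_ring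
  rw [h₄, h₁, h₂, h₃]
  module

/-- Strict midpoint convexity of `H ↦ Tr (M H⁻¹)` on positive definite matrices. -/
theorem PosDef.trace_mul_inv_midpoint_lt {M H P : Matrix n n ℝ} (hM : M.PosDef)
    (hH : H.PosDef) (hP : P.PosDef) (hne : H ≠ P) :
    (M * ((1 / 2 : ℝ) • (H + P))⁻¹).trace < ((M * H⁻¹).trace + (M * P⁻¹).trace) / 2 := by
  have hS := (hH.inv.add hP.inv).inv
  have hD : (H⁻¹ - P⁻¹)ᴴ = H⁻¹ - P⁻¹ := hH.inv.isHermitian.sub hP.inv.isHermitian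
  have hpsd := hS.posSemidef.mul_mul_conjTranspose_same (H⁻¹ - P⁻¹)
  rw [hD, ← hH.inv_add_inv_sub_inv_add hP] at hpsd
  have hpos : 0 < (M * (H⁻¹ + P⁻¹ - (4 : ℝ) • (H + P)⁻¹)).trace := by
    refine lt_of_le_of_ne (hM.trace_mul_nonneg hpsd) fun h => hne ?_
    have hzero := hM.trace_mul_eq_zero hpsd h.symm
    rw [hH.inv_add_inv_sub_inv_add hP] at hzero
    obtain ⟨B, hB, hBS⟩ := hS.exists_isUnit_conjTranspose_mul_self
    have hBD : B * (H⁻¹ - P⁻¹) = 0 := by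
      rw [← conjTranspose_mul_self_eq_zero, conjTranspose_mul, hD, ← hzero, hBS]
      simp only [mul_assoc]
    have hinv : H⁻¹ = P⁻¹ := sub_eq_zero.1 (hB.mul_right_eq_zero.1 hBD)
    rw [← nonsing_inv_nonsing_inv H ((isUnit_iff_isUnit_det _).1 hH.isUnit), hinv,
      nonsing_inv_nonsing_inv P ((isUnit_iff_isUnit_det _).1 hP.isUnit)]
  have hinv : ((1 / 2 : ℝ) • (H + P))⁻¹ = (2 : ℝ) • (H + P)⁻¹ := by
    refine inv_eq_right_inv ?_
    rw [smul_mul_smul_comm,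
      mul_nonsing_inv _ ((isUnit_iff_isUnit_det _).1 (hH.add hP).isUnit)]
    norm_num
  rw [hinv]
  simp only [mul_sub, mul_add, mul_smul_comm, trace_sub, trace_add, trace_smul,
    smul_eq_mul] at hpos ⊢
  linarith

/-- `H ↦ Tr (M H⁻¹) + c Tr H` attains its minimum over the positive definite matrices of a
subspace, provided that there is one. -/
theorem PosDef.exists_forall_trace_mul_inv_add_le {M : Matrix n n ℝ} (hM : M.PosDef) {c : ℝ}
    (hc : 0 < c) (V : Submodule ℝ (Matrix n n ℝ)) {H₀ : Matrix n n ℝ} (hV₀ : H₀ ∈ V)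
    (hH₀ : H₀.PosDef) :
    ∃ P ∈ V, P.PosDef ∧ ∀ H ∈ V, H.PosDef →
      (M * P⁻¹).trace + c * P.trace ≤ (M * H⁻¹).trace + c * H.trace := by
  let f : Matrix n n ℝ × Matrix n n ℝ → ℝ := fun p => (M * p.2).trace + c * p.1.trace
  have hf : Continuous f := by fun_prop
  have mem_inv : ∀ H : Matrix n n ℝ, H.PosDef → H * H⁻¹ = 1 := fun H hH =>
    mul_nonsing_inv _ ((isUnit_iff_isUnit_det _).1 hH.isUnit)
  let T : Set (Matrix n n ℝ × Matrix n n ℝ) :=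
    {p | p.1 ∈ V ∧ p.1.PosSemidef ∧ p.2.PosSemidef ∧ p.1 * p.2 = 1 ∧ f p ≤ f (H₀, H₀⁻¹)}
  have hclosed : IsClosed T :=
    (V.closed_of_finiteDimensional.preimage continuous_fst).inter <|
    (isClosed_setOf_posSemidef.preimage continuous_fst).inter <|
    (isClosed_setOf_posSemidef.preimage continuous_snd).inter <|
    (isClosed_eq (by fun_prop) continuous_const).inter (isClosed_le hf continuous_const)
  obtain ⟨S, hS, hTS⟩ := hM.exists_isCompact_of_trace_mul_le (f (H₀, H₀⁻¹))
  have hcompact : IsCompact T := by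
    refine ((isCompact_setOf_abs_apply_le (f (H₀, H₀⁻¹) / c)).prod hS).of_isClosed_subset
      hclosed ?_
    rintro ⟨H, G⟩ ⟨-, hH, hG, -, hle⟩
    have hHtr := mul_nonneg hc.le hH.trace_nonneg
    have hGtr := hM.trace_mul_nonneg hG
    change (M * G).trace + c * H.trace ≤ _ at hle
    refine ⟨fun i j => (hH.abs_apply_le_trace i j).trans ?_, hTS G hG (by linarith)⟩
    rw [le_div_iff₀ hc]
    linarith
  obtain ⟨⟨P, G⟩, ⟨hPV, hP, -, hPG, hP₀⟩, hmin⟩ := hcompact.exists_isMinOn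
    ⟨(H₀, H₀⁻¹), hV₀, hH₀.posSemidef, hH₀.inv.posSemidef, mem_inv H₀ hH₀, le_rfl⟩
    hf.continuousOn
  obtain rfl : P⁻¹ = G := inv_eq_right_inv hPG
  refine ⟨P, hPV, hP.posDef_iff_isUnit.2 (IsUnit.of_mul_eq_one _ hPG), fun H hHV hH => ?_⟩
  rcases le_total (f (H, H⁻¹)) (f (H₀, H₀⁻¹)) with hle | hle
  · exact hmin (a := (H, H⁻¹))
      ⟨hHV, hH.posSemidef, hH.inv.posSemidef, mem_inv H hH, hle⟩
  · exact hP₀.trans hle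

end Matrix

theorem stmt_1 {d : ℕ} (𝓗 : Set (Matrix (Fin d) (Fin d) ℝ)) (h𝓗 : WellStructured 𝓗)
    (η : ℝ) (hη : 0 < η) (M : Matrix (Fin d) (Fin d) ℝ) (hM : M.PosDef) :
    ∃! P : Matrix (Fin d) (Fin d) ℝ, P ∈ 𝓗 ∧ P.PosDef ∧
      ∀ H ∈ 𝓗, H.PosDef →
        (minner M P⁻¹ + η ^ 2 * P.trace ≤ minner M H⁻¹ + η ^ 2 * H.trace ∧
          (minner M P⁻¹ + η ^ 2 * P.trace = minner M H⁻¹ + η ^ 2 * H.trace → H = P)) := by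
  obtain ⟨K, ⟨hsmul, hadd, -, hone⟩, rfl⟩ := h𝓗
  let V : Submodule ℝ (Matrix (Fin d) (Fin d) ℝ) :=
    { carrier := K
      add_mem' := fun {a b} ha hb => hadd a ha b hb
      zero_mem' := by simpa using hsmul 0 1 hone
      smul_mem' := hsmul }
  have hMt : Mᵀ = M := by simpa [conjTranspose_eq_transpose_of_trivial] using hM.isHermitian.eq
  simp only [minner, hMt]
  obtain ⟨P, hPV, hP, hmin⟩ :=
    hM.exists_forall_trace_mul_inv_add_le (pow_pos hη 2) V (H₀ := 1) hone PosDef.one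
  refine ⟨P, ⟨⟨hPV, hP.posSemidef⟩, hP, fun H hHK hH => ⟨hmin H hHK.1 hH, fun heq => ?_⟩⟩,
    fun P' ⟨hP'K, hP', hmin'⟩ => ?_⟩
  · by_contra hne
    have hlt := hM.trace_mul_inv_midpoint_lt hH hP hne
    have hle := hmin ((1 / 2 : ℝ) • (H + P)) (V.smul_mem _ (V.add_mem hHK.1 hPV))
      ((hH.add hP).smul (by norm_num))
    simp only [trace_smul, trace_add, smul_eq_mul] at hle
    linarith
  · have hPP' := hmin' P ⟨hPV, hP.posSemidef⟩ hP
    exact (hPP'.2 (le_antisymm hPP'.1 (hmin P' hP'K.1 hP'))).symm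
end

section
/- Let 𝓗 be a well-structured preconditioner set in dimension d, let η > 0, let M be a symmetric positive definite d×d real matrix, and let P ∈ 𝓗 be positive definite with ⟨M, P⁻¹⟩ + η²·Tr(P) ≤ ⟨M, H⁻¹⟩ + η²·Tr(H) for every positive definite H ∈ 𝓗. Then ⟨M, P⁻¹⟩ = η²·Tr(P). -/
open Matrix

/-- If `t ↦ a * t⁻¹ + b * t` on the positive reals is minimal at `t = 1`, then `a = b`. -/
lemma eq_of_forall_pos_add_le_mul_inv_add_mul {a b : ℝ}
    (h : ∀ t : ℝ, 0 < t → a + b ≤ a * t⁻¹ + b * t) : a = b := by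
  have hmin : IsLocalMin (fun t : ℝ => a * t⁻¹ + b * t) 1 := by
    filter_upwards [lt_mem_nhds (zero_lt_one' ℝ)] with t ht
    simpa using h t ht
  have hderiv := ((hasDerivAt_inv (one_ne_zero' ℝ)).const_mul a).add
    ((hasDerivAt_id (1 : ℝ)).const_mul b)
  have hzero := hmin.hasDerivAt_eq_zero hderiv
  norm_num at hzero
  linarith

theorem stmt_2 {d : ℕ} (𝓗 : Set (Matrix (Fin d) (Fin d) ℝ)) (h𝓗 : WellStructured 𝓗)
    (η : ℝ) (hη : 0 < η) (M : Matrix (Fin d) (Fin d) ℝ) (hM : M.PosDef)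
    (P : Matrix (Fin d) (Fin d) ℝ) (hP𝓗 : P ∈ 𝓗) (hP : P.PosDef)
    (hmin : ∀ H ∈ 𝓗, H.PosDef →
      minner M P⁻¹ + η ^ 2 * P.trace ≤ minner M H⁻¹ + η ^ 2 * H.trace) :
    minner M P⁻¹ = η ^ 2 * P.trace := by
  obtain ⟨K, ⟨hsmul, -, -, -⟩, rfl⟩ := h𝓗
  refine eq_of_forall_pos_add_le_mul_inv_add_mul fun t ht => ?_
  have hle := hmin (t • P) ⟨hsmul t P hP𝓗.1, (hP.smul ht).posSemidef⟩ (hP.smul ht)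
  have hinv : (t • P)⁻¹ = t⁻¹ • P⁻¹ :=
    Matrix.inv_smul' P (Units.mk0 t ht.ne') hP.det_pos.ne'.isUnit
  have hinner : minner M (t⁻¹ • P⁻¹) = minner M P⁻¹ * t⁻¹ := by
    simp [minner, mul_comm]
  rw [hinv, hinner, Matrix.trace_smul, smul_eq_mul] at hle
  linarith
end

section
/- Let 𝓗 be a well-structured preconditioner set in dimension d and let x_1,…,x_{T+1}, g_t, M_t, H_t be AdaReg iterates with preconditioner set 𝓗, parameters ε > 0 and η > 0, convex set 𝒳, and differentiable convex losses L_1,…,L_T. Let H_0 be a positive definite element of 𝓗 minimizing H ↦ ⟨M_0, H⁻¹⟩ + η²·Tr(H) over positive definite H ∈ 𝓗. Then for every x* ∈ 𝒳: Σ_{t=1}^T L_t(x_t) − Σ_{t=1}^T L_t(x*) ≤ (1/2)·(⟨M_T, H_T⁻¹⟩ + η²·Tr(H_T) − η²·Tr(H_0)) + (1/2)·Σ_{t=1}^T ((x_t − x*)ᵀ H_t (x_t − x*) − (x_{t+1} − x*)ᵀ H_t (x_{t+1} − x*)). -/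
open Matrix

/-- The `𝓗`-norm `‖x‖_𝓗 = sup{√(xᵀHx) : H ∈ 𝓗, Tr(H) ≤ 1}`. -/
noncomputable def hNorm {d : ℕ} (𝓗 : Set (Matrix (Fin d) (Fin d) ℝ)) (x : Fin d → ℝ) : ℝ :=
  sSup {r | ∃ H ∈ 𝓗, H.trace ≤ 1 ∧ r = Real.sqrt (x ⬝ᵥ H.mulVec x)}

/-- The adaptive gradient norm `|||g_{1:T}|||_𝓗`. -/
noncomputable def adaNorm {d : ℕ} (𝓗 : Set (Matrix (Fin d) (Fin d) ℝ)) (T : ℕ)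
    (g : ℕ → Fin d → ℝ) : ℝ :=
  sInf {r | ∃ H ∈ 𝓗, H.PosDef ∧ H.trace ≤ 1 ∧
    r = Real.sqrt (∑ s ∈ Finset.Icc 1 T, g s ⬝ᵥ H⁻¹.mulVec (g s))}

/-- The gradient of `f : ℝ^d → ℝ` at `x`, componentwise. -/
noncomputable def grad {d : ℕ} (f : (Fin d → ℝ) → ℝ) (x : Fin d → ℝ) : Fin d → ℝ :=
  fun i => fderiv ℝ f x (Pi.single i 1)

/-- AdaReg iterates (Algorithm 1) with preconditioner set `𝓗`, parameters `ε, η`,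
constraint set `𝒳` and differentiable convex losses `L 1, …, L T`. -/
def AdaReg {d : ℕ} (𝓗 : Set (Matrix (Fin d) (Fin d) ℝ)) (ε η : ℝ)
    (𝒳 : Set (Fin d → ℝ)) (T : ℕ) (L : ℕ → (Fin d → ℝ) → ℝ)
    (x g : ℕ → Fin d → ℝ) (M H : ℕ → Matrix (Fin d) (Fin d) ℝ) : Prop :=
  x 1 ∈ 𝒳 ∧ M 0 = ε • (1 : Matrix (Fin d) (Fin d) ℝ) ∧
  ∀ t, 1 ≤ t → t ≤ T →
    Differentiable ℝ (L t) ∧ ConvexOn ℝ Set.univ (L t) ∧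
    g t = grad (L t) (x t) ∧
    M t = M (t - 1) + Matrix.vecMulVec (g t) (g t) ∧
    H t ∈ 𝓗 ∧ (H t).PosDef ∧
    (∀ H' ∈ 𝓗, H'.PosDef →
      minner (M t) (H t)⁻¹ + η ^ 2 * (H t).trace ≤ minner (M t) H'⁻¹ + η ^ 2 * H'.trace) ∧
    x (t + 1) ∈ 𝒳 ∧
    (∀ y ∈ 𝒳,
      (x (t + 1) - (x t - (H t)⁻¹.mulVec (g t))) ⬝ᵥ
          (H t).mulVec (x (t + 1) - (x t - (H t)⁻¹.mulVec (g t))) ≤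
      (y - (x t - (H t)⁻¹.mulVec (g t))) ⬝ᵥ
          (H t).mulVec (y - (x t - (H t)⁻¹.mulVec (g t))))

/-- First-order lower bound for a differentiable convex function, in terms of `grad`. -/
theorem ConvexOn.sub_le_grad_dotProduct {d : ℕ} {f : (Fin d → ℝ) → ℝ}
    (hf : ConvexOn ℝ Set.univ f) {a : Fin d → ℝ} (hd : DifferentiableAt ℝ f a)
    (b : Fin d → ℝ) : f a - f b ≤ grad f a ⬝ᵥ (a - b) := by
  have hline : ConvexOn ℝ Set.univ (f ∘ AffineMap.lineMap (k := ℝ) a b) := by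
    simpa using hf.comp_affineMap (AffineMap.lineMap (k := ℝ) a b)
  have hderiv : HasDerivAt (f ∘ AffineMap.lineMap (k := ℝ) a b) (fderiv ℝ f a (b - a)) 0 := by
    refine HasFDerivAt.comp_hasDerivAt (0 : ℝ) ?_ AffineMap.hasDerivAt_lineMap
    simpa using hd.hasFDerivAt
  have hslope := hline.le_slope_of_hasDerivAt (Set.mem_univ 0) (Set.mem_univ 1) one_pos hderiv
  have hgrad : fderiv ℝ f a (b - a) = -(grad f a ⬝ᵥ (a - b)) := by
    rw [← dotProduct_neg, neg_sub, ← ContinuousLinearMap.coe_coe,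
      LinearMap.pi_apply_eq_sum_univ]
    refine Finset.sum_congr rfl fun i _ => ?_
    have hbasis : (fun j => if i = j then (1 : ℝ) else 0) = Pi.single i 1 := by
      ext j
      simp [Pi.single_apply, eq_comm]
    rw [smul_eq_mul, mul_comm, hbasis]
    rfl
  simp only [slope, Function.comp_apply, AffineMap.lineMap_apply_one,
    AffineMap.lineMap_apply_zero, vsub_eq_sub, sub_zero, inv_one, one_smul] at hslope
  linarith

theorem Matrix.IsHermitian.dotProduct_mulVec_comm {n : Type*} [Fintype n] {A : Matrix n n ℝ}
    (hA : A.IsHermitian) (u v : n → ℝ) : u ⬝ᵥ A.mulVec v = v ⬝ᵥ A.mulVec u := by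
  rw [dotProduct_mulVec, ← mulVec_transpose, ← conjTranspose_eq_transpose_of_trivial, hA.eq,
    dotProduct_comm]

theorem Matrix.IsHermitian.quadForm_add {n : Type*} [Fintype n] {A : Matrix n n ℝ}
    (hA : A.IsHermitian) (u v : n → ℝ) :
    (u + v) ⬝ᵥ A.mulVec (u + v) =
      u ⬝ᵥ A.mulVec u + 2 * (u ⬝ᵥ A.mulVec v) + v ⬝ᵥ A.mulVec v := by
  rw [mulVec_add, add_dotProduct, dotProduct_add, dotProduct_add,
    hA.dotProduct_mulVec_comm v u]
  ring

/-- Projecting onto a convex set in the seminorm of a positive semidefinite matrix does not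
increase the distance to the points of the set. -/
theorem Matrix.PosSemidef.quadForm_proj_le {n : Type*} [Fintype n] {A : Matrix n n ℝ}
    (hA : A.PosSemidef) {S : Set (n → ℝ)} (hS : Convex ℝ S) {z p y : n → ℝ}
    (hp : p ∈ S) (hy : y ∈ S)
    (hmin : ∀ w ∈ S, (p - z) ⬝ᵥ A.mulVec (p - z) ≤ (w - z) ⬝ᵥ A.mulVec (w - z)) :
    (p - y) ⬝ᵥ A.mulVec (p - y) ≤ (z - y) ⬝ᵥ A.mulVec (z - y) := by
  have hstep : ∀ s : ℝ, 0 < s → s ≤ 1 →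
      0 ≤ 2 * ((p - z) ⬝ᵥ A.mulVec (y - p)) + s * ((y - p) ⬝ᵥ A.mulVec (y - p)) := by
    intro s hs hs1
    have h := hmin _ (hS.add_smul_sub_mem hp hy ⟨hs.le, hs1⟩)
    rw [show p + s • (y - p) - z = (p - z) + s • (y - p) by abel,
      hA.isHermitian.quadForm_add (p - z)] at h
    simp only [mulVec_smul, dotProduct_smul, smul_dotProduct, smul_eq_mul] at h
    refine nonneg_of_mul_nonneg_right (a := s) ?_ hs
    linarith
  have hq : 0 ≤ (y - p) ⬝ᵥ A.mulVec (y - p) := by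
    simpa using hA.dotProduct_mulVec_nonneg (y - p)
  have hcross : 0 ≤ (p - z) ⬝ᵥ A.mulVec (y - p) := by
    by_contra! hneg
    set c := (p - z) ⬝ᵥ A.mulVec (y - p)
    set q := (y - p) ⬝ᵥ A.mulVec (y - p)
    have hpos : 0 < q - c := by linarith
    have hs := hstep (-c / (q - c)) (div_pos (by linarith) hpos)
      ((div_le_one hpos).2 (by linarith))
    have hlt : -c / (q - c) * q ≤ -c := by
      rw [div_mul_eq_mul_div, div_le_iff₀ hpos]
      nlinarith
    linarith
  have hsplit := hA.isHermitian.quadForm_add (p - z) (y - p)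
  rw [show p - z + (y - p) = -(z - y) by abel] at hsplit
  have hz : 0 ≤ (p - z) ⬝ᵥ A.mulVec (p - z) := by
    simpa using hA.dotProduct_mulVec_nonneg (p - z)
  have hpy : (p - y) ⬝ᵥ A.mulVec (p - y) = (y - p) ⬝ᵥ A.mulVec (y - p) := by
    rw [← neg_sub y p, mulVec_neg, neg_dotProduct_neg]
  rw [mulVec_neg, neg_dotProduct_neg] at hsplit
  linarith

theorem Matrix.PosDef.quadForm_sub_inv_mulVec {n : Type*} [Fintype n] [DecidableEq n]
    {A : Matrix n n ℝ} (hA : A.PosDef) (u g : n → ℝ) :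
    (u - A⁻¹.mulVec g) ⬝ᵥ A.mulVec (u - A⁻¹.mulVec g) =
      u ⬝ᵥ A.mulVec u - 2 * (g ⬝ᵥ u) + g ⬝ᵥ A⁻¹.mulVec g := by
  have hinv : A.mulVec (A⁻¹.mulVec g) = g := by
    rw [mulVec_mulVec, mul_nonsing_inv _ ((isUnit_iff_isUnit_det A).1 hA.isUnit), one_mulVec]
  rw [sub_eq_add_neg, hA.isHermitian.quadForm_add, mulVec_neg, hinv, neg_dotProduct_neg,
    dotProduct_neg, dotProduct_comm u g, dotProduct_comm _ g]
  ring

theorem minner_add_vecMulVec {n : Type*} [Fintype n] (A B : Matrix n n ℝ) (g : n → ℝ) :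
    minner (A + vecMulVec g g) B = minner A B + g ⬝ᵥ B.mulVec g := by
  rw [minner, minner, transpose_add, add_mul, trace_add, transpose_vecMulVec, vecMulVec_mul,
    trace_vecMulVec, dotProduct_comm g (g ᵥ* B), dotProduct_mulVec]

/-- Regret of one preconditioned projected gradient step. -/
theorem Matrix.PosDef.projected_step_regret {d : ℕ} {A : Matrix (Fin d) (Fin d) ℝ}
    (hA : A.PosDef) {S : Set (Fin d → ℝ)} (hS : Convex ℝ S) {f : (Fin d → ℝ) → ℝ}
    (hf : ConvexOn ℝ Set.univ f) {a p y : Fin d → ℝ} (hd : DifferentiableAt ℝ f a)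
    (hp : p ∈ S) (hy : y ∈ S)
    (hmin : ∀ w ∈ S, (p - (a - A⁻¹.mulVec (grad f a))) ⬝ᵥ
        A.mulVec (p - (a - A⁻¹.mulVec (grad f a))) ≤
      (w - (a - A⁻¹.mulVec (grad f a))) ⬝ᵥ A.mulVec (w - (a - A⁻¹.mulVec (grad f a)))) :
    f a - f y ≤ (1 / 2) * (grad f a ⬝ᵥ A⁻¹.mulVec (grad f a)) +
      (1 / 2) * ((a - y) ⬝ᵥ A.mulVec (a - y) - (p - y) ⬝ᵥ A.mulVec (p - y)) := by
  have hgrad := hf.sub_le_grad_dotProduct hd y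
  have hproj := hA.posSemidef.quadForm_proj_le hS hp hy hmin
  rw [sub_right_comm, hA.quadForm_sub_inv_mulVec] at hproj
  linarith

theorem stmt_6 {d : ℕ} (𝓗 : Set (Matrix (Fin d) (Fin d) ℝ)) (h𝓗 : WellStructured 𝓗)
    (ε η : ℝ) (hε : 0 < ε) (hη : 0 < η)
    (𝒳 : Set (Fin d → ℝ)) (h𝒳conv : Convex ℝ 𝒳) (h𝒳ne : 𝒳.Nonempty)
    (T : ℕ) (L : ℕ → (Fin d → ℝ) → ℝ)
    (x g : ℕ → Fin d → ℝ) (M H : ℕ → Matrix (Fin d) (Fin d) ℝ)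
    (hiter : AdaReg 𝓗 ε η 𝒳 T L x g M H)
    (hH0 : H 0 ∈ 𝓗 ∧ (H 0).PosDef ∧ ∀ H' ∈ 𝓗, H'.PosDef →
      minner (M 0) (H 0)⁻¹ + η ^ 2 * (H 0).trace ≤ minner (M 0) H'⁻¹ + η ^ 2 * H'.trace) :
    ∀ xstar ∈ 𝒳,
      ∑ t ∈ Finset.Icc 1 T, L t (x t) - ∑ t ∈ Finset.Icc 1 T, L t xstar ≤
        (1 / 2) * (minner (M T) (H T)⁻¹ + η ^ 2 * (H T).trace - η ^ 2 * (H 0).trace) +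
        (1 / 2) * ∑ t ∈ Finset.Icc 1 T,
          ((x t - xstar) ⬝ᵥ (H t).mulVec (x t - xstar) -
            (x (t + 1) - xstar) ⬝ᵥ (H t).mulVec (x (t + 1) - xstar)) := by
  intro xstar hxs
  obtain ⟨-, hM0, hit⟩ := hiter
  have key : ∀ n ≤ T, ∑ t ∈ Finset.Icc 1 n, L t (x t) - ∑ t ∈ Finset.Icc 1 n, L t xstar ≤
      (1 / 2) * (minner (M n) (H n)⁻¹ + η ^ 2 * (H n).trace - η ^ 2 * (H 0).trace) +
      (1 / 2) * ∑ t ∈ Finset.Icc 1 n,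
        ((x t - xstar) ⬝ᵥ (H t).mulVec (x t - xstar) -
          (x (t + 1) - xstar) ⬝ᵥ (H t).mulVec (x (t + 1) - xstar)) := by
    intro n
    induction n with
    | zero =>
      intro _
      have htrace : 0 ≤ ε * ((H 0)⁻¹).trace :=
        mul_nonneg hε.le hH0.2.1.inv.posSemidef.trace_nonneg
      have hinner : minner (M 0) (H 0)⁻¹ = ε * ((H 0)⁻¹).trace := by simp [minner, hM0]
      simp only [zero_lt_one, Finset.Icc_eq_empty_of_lt, Finset.sum_empty, hinner]
      linarith
    | succ n ih =>
      intro hn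
      obtain ⟨hdiff, hconv, hg, hM, hHmem, hHpos, -, hxmem, hmin⟩ := hit (n + 1) (by lia) hn
      have hopt : minner (M n) (H n)⁻¹ + η ^ 2 * (H n).trace ≤
          minner (M n) (H (n + 1))⁻¹ + η ^ 2 * (H (n + 1)).trace := by
        rcases Nat.eq_zero_or_pos n with rfl | hpos
        · exact hH0.2.2 _ hHmem hHpos
        · obtain ⟨-, -, -, -, -, -, hbest, -⟩ := hit n hpos (by lia)
          exact hbest _ hHmem hHpos
      rw [hg] at hmin
      have hstep := hHpos.projected_step_regret h𝒳conv hconv (hdiff _) hxmem hxs hmin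
      rw [← hg] at hstep
      have hinner := minner_add_vecMulVec (M n) (H (n + 1))⁻¹ (g (n + 1))
      rw [Nat.add_sub_cancel] at hM
      rw [← hM] at hinner
      simp only [Finset.sum_Icc_succ_top (Nat.le_add_left 1 n)]
      linarith [ih (by lia)]
  exact key T le_rfl
end
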